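/- Paraproduct error bound (Lemma 5.4): Let s > (d+1)/2. There is a constant C, depending on d, s, k and χ, such that for every f ∈ H^s(𝕋^d) and every u ∈ L²(𝕋^d), ‖(T_f − f)u‖_{H^{0,1/2}(𝕋^d)} ≤ C ‖f‖_{H^s} ‖u‖_{L²}, where T_f u := Σ_{m} (P^α_{≤ m−5} f)·(P^α_{2^m} u) is the low–high paraproduct in the α-direction. -/

import Mathlib

noncomputable section
open scoped BigOperators
open Filter

/-- The frequency lattice `ℤ^d` of the torus `𝕋^d`. -/
abbrev Freq (d : ℕ) := Fin d → ℤ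

/-- A function on `𝕋^d`, represented by its sequence of Fourier coefficients. -/
abbrev Coeffs (d : ℕ) := Freq d → ℂ

variable {d : ℕ}

/-- The pairing `⟨j, k⟩` between a lattice frequency and the frequency vector `k ∈ ℝ^d`. -/
def dotk (k : Fin d → ℝ) (j : Freq d) : ℝ := ∑ i, (j i : ℝ) * k i

/-- The Japanese bracket `⟨j⟩ = (1+|j|²)^{1/2}`. -/
def jb (j : Freq d) : ℝ := Real.sqrt (1 + ∑ i, ((j i : ℝ)) ^ 2)

/-- The entries of `k` are linearly independent over `ℚ` (equivalently, over `ℤ`). -/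
def Indep (k : Fin d → ℝ) : Prop := ∀ j : Freq d, dotk k j = 0 → j = 0

/-- The weight defining the anisotropic Sobolev norm `H^{s,θ}`. -/
def wt (k : Fin d → ℝ) (s θ : ℝ) (j : Freq d) : ℝ :=
  jb j ^ (2 * s) * (1 + (dotk k j) ^ 2) ^ θ

/-- Membership in the anisotropic Sobolev space `H^{s,θ}(𝕋^d)`. -/
def MemSob (k : Fin d → ℝ) (s θ : ℝ) (u : Coeffs d) : Prop :=
  Summable (fun j : Freq d => wt k s θ j * ‖u j‖ ^ 2)

/-- The `H^{s,θ}(𝕋^d)` norm. -/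
def sobNorm (k : Fin d → ℝ) (s θ : ℝ) (u : Coeffs d) : ℝ :=
  Real.sqrt (∑' j : Freq d, wt k s θ j * ‖u j‖ ^ 2)

/-- Membership in the Sobolev space `H^s(𝕋^d)`; `H^0 = L²`. -/
def MemHs (s : ℝ) (u : Coeffs d) : Prop :=
  Summable (fun j : Freq d => jb j ^ (2 * s) * ‖u j‖ ^ 2)

/-- The `H^s(𝕋^d)` norm; for `s = 0` this is the `L²(𝕋^d)` norm (spectrally normalized). -/
def HsNorm (s : ℝ) (u : Coeffs d) : ℝ :=
  Real.sqrt (∑' j : Freq d, jb j ^ (2 * s) * ‖u j‖ ^ 2)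

/-- The value of the function with Fourier coefficients `u` at the point `α ∈ 𝕋^d = ℝ^d/(2πℤ)^d`,
namely `Σ_j û_j e^{i⟨j,α⟩}`. -/
def value (u : Coeffs d) (α : Fin d → ℝ) : ℂ :=
  ∑' j : Freq d, u j * Complex.exp (Complex.I * ((∑ i, (j i : ℝ) * α i : ℝ) : ℂ))

/-- The squared norm of the space `ℋ^σ = H^σ × H^{σ,1/2}`. -/
def HHnormSq (k : Fin d → ℝ) (σ : ℝ) (W R : Coeffs d) : ℝ :=
  HsNorm σ W ^ 2 + sobNorm k σ (1/2) R ^ 2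

/-- The norm of the space `ℋ^σ = H^σ × H^{σ,1/2}`. -/
def HHnorm (k : Fin d → ℝ) (σ : ℝ) (W R : Coeffs d) : ℝ :=
  Real.sqrt (HHnormSq k σ W R)

/-- Membership in `ℋ^σ = H^σ × H^{σ,1/2}`. -/
def MemHH (k : Fin d → ℝ) (σ : ℝ) (W R : Coeffs d) : Prop :=
  MemHs σ W ∧ MemSob k σ (1/2) R

/-- The directional derivative `∂_α = k₁∂₁+⋯+k_d∂_d`, acting on Fourier coefficients
by multiplication by `i⟨j,k⟩`. -/
def dAl (k : Fin d → ℝ) (u : Coeffs d) : Coeffs d :=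
  fun j => Complex.I * (dotk k j : ℝ) * u j

/-- The projection `P`: the Fourier multiplier which is `1` for `⟨j,k⟩ < 0`, `1/2`
at the zero mode, `0` for `⟨j,k⟩ > 0`. -/
def Pp (k : Fin d → ℝ) (u : Coeffs d) : Coeffs d := fun j =>
  if dotk k j < 0 then u j else if dotk k j = 0 then u j / 2 else 0

/-- The complementary projection `P̄ = I - P`. -/
def Pb (k : Fin d → ℝ) (u : Coeffs d) : Coeffs d := u - Pp k u

/-- The Fourier coefficients of the complex conjugate function. -/
def conjC (u : Coeffs d) : Coeffs d := fun j => (starRingEnd ℂ) (u (-j))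

/-- The Fourier coefficients of the product of two functions (convolution). -/
def cmul (u v : Coeffs d) : Coeffs d := fun j => ∑' m : Freq d, u m * v (j - m)

/-- The Fourier coefficients of the constant function `1`. -/
def oneC : Coeffs d := fun j => if j = 0 then 1 else 0

/-- `u` is holomorphic: its Fourier coefficients vanish for `⟨j,k⟩ > 0`. -/
def Holo (k : Fin d → ℝ) (u : Coeffs d) : Prop := ∀ j : Freq d, 0 < dotk k j → u j = 0

/-- The coefficients of `2 Re u`. -/
def twoRe (u : Coeffs d) : Coeffs d := u + conjC u

/-- The coefficients of `2 Im u`. -/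
def twoIm (u : Coeffs d) : Coeffs d := fun j => (u j - conjC u j) / Complex.I

/-- The coefficients of `u²`. -/
def csq (u : Coeffs d) : Coeffs d := cmul u u

/-- The coefficients of `|u|² = u·conj(u)`. -/
def absSqC (u : Coeffs d) : Coeffs d := cmul u (conjC u)

/-- The advection velocity `b := 2 Re P[R(1-conj Y)]`. -/
def bC (k : Fin d → ℝ) (R Y : Coeffs d) : Coeffs d :=
  twoRe (Pp k (cmul R (oneC - conjC Y)))

/-- The frequency shift `a := i(P̄[conj(R)·R_α] - P[R·conj(R)_α])`. -/
def aCf (k : Fin d → ℝ) (R : Coeffs d) : Coeffs d := fun j =>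
  Complex.I * ((Pb k (cmul (conjC R) (dAl k R)) - Pp k (cmul R (dAl k (conjC R)))) j)

/-- The auxiliary function
`M := P̄[conj(R)·Y_α − R_α·conj(Y)] + P[R·conj(Y)_α − conj(R)_α·Y]`. -/
def MCf (k : Fin d → ℝ) (R Y : Coeffs d) : Coeffs d :=
  Pb k (cmul (conjC R) (dAl k Y) - cmul (dAl k R) (conjC Y))
    + Pp k (cmul R (dAl k (conjC Y)) - cmul (dAl k (conjC R)) Y)

/-- `(W,R,Y)` solves the differentiated gravity water wave system on the time interval `I`:
`𝐖_t + b·𝐖_α + (1+𝐖)(1−conj Y)·R_α = (1+𝐖)M` and `R_t + b·R_α = i(Y − a(1−Y))`,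
where `Y = 𝐖/(1+𝐖)` (equivalently `(1+𝐖)·Y = 𝐖`), so that
`(1+𝐖)/(1+conj 𝐖) = (1+𝐖)(1−conj Y)` and `i(𝐖−a)/(1+𝐖) = i(Y − a(1−Y))`. -/
structure IsWWSol (k : Fin d → ℝ) (I : Set ℝ) (W R Y : ℝ → Coeffs d) : Prop where
  holoW : ∀ t ∈ I, Holo k (W t)
  holoR : ∀ t ∈ I, Holo k (R t)
  Ymem : ∀ t ∈ I, MemHs 0 (Y t)
  Ydef : ∀ t ∈ I, cmul (oneC + W t) (Y t) = W t
  eqW : ∀ t ∈ I, ∀ j : Freq d,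
    HasDerivWithinAt (fun τ => W τ j)
      ((cmul (oneC + W t) (MCf k (R t) (Y t))
        - cmul (bC k (R t) (Y t)) (dAl k (W t))
        - cmul (cmul (oneC + W t) (oneC - conjC (Y t))) (dAl k (R t))) j) I t
  eqR : ∀ t ∈ I, ∀ j : Freq d,
    HasDerivWithinAt (fun τ => R τ j)
      ((Complex.I • (Y t - cmul (aCf k (R t)) (oneC - Y t))
        - cmul (bC k (R t) (Y t)) (dAl k (R t))) j) I t

/-- The Littlewood–Paley projection `P_λ^α` at dyadic frequency `λ = 2^l`, adapted to the
quasiperiodic direction: for `l ≥ 1` the Fourier multiplier `j ↦ φ(2^{-l}⟨j,k⟩)` with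
`φ(ξ) = χ(ξ) - χ(2ξ)`, and for `l = 0` the multiplier `j ↦ χ(⟨j,k⟩)`. -/
def LPproj (k : Fin d → ℝ) (χ : ℝ → ℝ) (l : ℕ) (u : Coeffs d) : Coeffs d :=
  fun j =>
    if l = 0 then ((χ (dotk k j) : ℝ) : ℂ) * u j
    else (((χ ((2:ℝ) ^ (-(l:ℝ)) * dotk k j) - χ ((2:ℝ) ^ (-(l:ℝ) + 1) * dotk k j) : ℝ)) : ℂ) * u j
/-- The low-frequency cutoff `P^α_{≤ m}` in the quasiperiodic direction: the Fourier
multiplier `j ↦ χ(2^{-m}⟨j,k⟩)`, with `P^α_{≤ m} = 0` for `m < 0`. -/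
def LPle (k : Fin d → ℝ) (χ : ℝ → ℝ) (m : ℤ) (u : Coeffs d) : Coeffs d :=
  fun j => if m < 0 then 0 else ((χ ((2:ℝ) ^ (-(m:ℝ)) * dotk k j) : ℝ) : ℂ) * u j

/-- The low–high paraproduct in the `α` direction:
`T_f u := Σ_m (P^α_{≤ m-5} f)·(P^α_{2^m} u)`. -/
def Tpara (k : Fin d → ℝ) (χ : ℝ → ℝ) (f u : Coeffs d) : Coeffs d :=
  fun j => ∑' m : ℕ, cmul (LPle k χ ((m : ℤ) - 5) f) (LPproj k χ m u) j


lemma aux_jb_one_le (j : Freq d) : 1 ≤ jb j := by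
  unfold jb
  rw [Real.one_le_sqrt]
  have : 0 ≤ ∑ i, ((j i : ℝ)) ^ 2 := Finset.sum_nonneg fun i _ => sq_nonneg _
  linarith

lemma aux_abs_le_jb (j : Freq d) (i : Fin d) : |(j i : ℝ)| ≤ jb j := by
  unfold jb
  apply Real.abs_le_sqrt
  have := Finset.single_le_sum (f := fun i => ((j i : ℝ)) ^ 2) (fun i _ => sq_nonneg _)
    (Finset.mem_univ i)
  linarith

lemma aux_dotk_le (k : Fin d → ℝ) (j : Freq d) :
    1 + |dotk k j| ≤ (1 + ∑ i, |k i|) * jb j := by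
  have h1 := aux_jb_one_le j
  have : |dotk k j| ≤ (∑ i, |k i|) * jb j := by
    unfold dotk
    refine (Finset.abs_sum_le_sum_abs _ _).trans ?_
    rw [Finset.sum_mul]
    refine Finset.sum_le_sum fun i _ => ?_
    rw [abs_mul, mul_comm]
    exact mul_le_mul_of_nonneg_left (aux_abs_le_jb j i) (abs_nonneg _)
  linarith

lemma aux_dotk_add (k : Fin d → ℝ) (a b : Freq d) : dotk k (a - b) = dotk k a - dotk k b := by
  unfold dotk
  rw [← Finset.sum_sub_distrib]
  refine Finset.sum_congr rfl fun i _ => ?_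
  simp [sub_mul]

lemma aux_summable_jb (r : ℝ) (hr : r < -(d : ℝ)) :
    Summable (fun j : Freq d => jb j ^ r) := by
  classical
  let L := Submodule.span ℤ (Set.range (Pi.basisFun ℝ (Fin d)))
  have hrank : Module.finrank ℤ L = d := by
    rw [ZLattice.rank ℝ L]; simp
  have hS := ZLattice.summable_norm_rpow L r (by rw [hrank]; exact hr)
  let e : Freq d → L := fun j => ⟨fun i => (j i : ℝ), by
    rw [(Pi.basisFun ℝ (Fin d)).mem_span_iff_repr_mem ℤ]
    intro i
    simp⟩
  have he : Function.Injective e := by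
    intro a b h
    funext i
    have := congrArg (fun z : L => (z : Fin d → ℝ) i) h
    simpa [e] using this
  have hS2 := hS.comp_injective he
  refine Summable.of_norm_bounded_eventually hS2 ?_
  have : ({0}ᶜ : Set (Freq d)) ∈ cofinite := (Set.finite_singleton _).compl_mem_cofinite
  filter_upwards [this] with j hj
  have hj0 : j ≠ 0 := hj
  have hpos := lt_of_lt_of_le one_pos (aux_jb_one_le j)
  rw [Real.norm_of_nonneg (Real.rpow_nonneg hpos.le _)]
  have hd0 : (0:ℝ) ≤ d := Nat.cast_nonneg _
  have hej : e j ≠ 0 := by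
    intro h
    apply hj0
    apply he
    rw [h]
    ext i
    simp [e]
  refine Real.rpow_le_rpow_of_nonpos (norm_pos_iff.2 hej) ?_ (by linarith)
  change ‖(fun i => (j i : ℝ))‖ ≤ _
  rw [pi_norm_le_iff_of_nonneg hpos.le]
  intro i
  exact aux_abs_le_jb j i

open scoped ENNReal in
lemma aux_CS {ι : Type*} (x y : ι → ℝ≥0∞) :
    (∑' i, x i * y i) ^ 2 ≤ (∑' i, x i ^ 2) * (∑' i, y i ^ 2) := by
  have h : ∑' i, x i * y i ≤ (∑' i, x i ^ 2) ^ (1/2:ℝ) * (∑' i, y i ^ 2) ^ (1/2:ℝ) := by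
    rw [ENNReal.tsum_eq_iSup_sum]
    refine iSup_le fun t => ?_
    have := ENNReal.inner_le_Lp_mul_Lq t x y Real.HolderConjugate.two_two
    simp only [ENNReal.rpow_two] at this
    refine this.trans ?_
    gcongr <;> exact ENNReal.sum_le_tsum _
  calc _ ≤ ((∑' i, x i ^ 2) ^ (1/2:ℝ) * (∑' i, y i ^ 2) ^ (1/2:ℝ)) ^ 2 := by gcongr
    _ = _ := by
      rw [mul_pow, ← ENNReal.rpow_two, ← ENNReal.rpow_two, ← ENNReal.rpow_mul, ← ENNReal.rpow_mul]
      norm_num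

open scoped ENNReal in
lemma aux_young (a b : Freq d → ℝ≥0∞) :
    ∑' j, (∑' n, a n * b (j - n)) ^ 2 ≤ (∑' n, a n) ^ 2 * ∑' j, b j ^ 2 := by
  have hp : ∀ j, (∑' n, a n * b (j - n)) ^ 2 ≤ (∑' n, a n) * ∑' n, a n * b (j - n) ^ 2 := by
    intro j
    have := aux_CS (fun n => a n ^ (1/2:ℝ)) (fun n => a n ^ (1/2:ℝ) * b (j - n))
    have h2 : ∀ z : ℝ≥0∞, (z ^ (1/2:ℝ)) ^ 2 = z := by
      intro z
      rw [← ENNReal.rpow_two, ← ENNReal.rpow_mul]; norm_num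
    simp only [← mul_assoc, ← sq, mul_pow, h2] at this
    exact this
  calc _ ≤ ∑' j, (∑' n, a n) * ∑' n, a n * b (j - n) ^ 2 := ENNReal.tsum_le_tsum hp
    _ = (∑' n, a n) * ∑' n, a n * ∑' j, b (j - n) ^ 2 := by
      rw [ENNReal.tsum_mul_left, ENNReal.tsum_comm]
      simp only [ENNReal.tsum_mul_left]
    _ = _ := by
      have : ∀ n : Freq d, ∑' j, b (j - n) ^ 2 = ∑' j, b j ^ 2 := fun n =>
        (Equiv.subRight n).tsum_eq (fun j => b j ^ 2)
      simp only [this]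
      rw [ENNReal.tsum_mul_right, sq, mul_assoc]

/-- The Littlewood–Paley symbol. -/
def auxPhi (χ : ℝ → ℝ) (m : ℕ) (x : ℝ) : ℝ :=
  if m = 0 then χ x else χ ((2:ℝ) ^ (-(m:ℝ)) * x) - χ ((2:ℝ) ^ (-(m:ℝ) + 1) * x)

/-- low frequency symbol. -/
def auxLow (χ : ℝ → ℝ) (m : ℤ) (y : ℝ) : ℝ :=
  if m < 0 then 0 else χ ((2:ℝ) ^ (-(m:ℝ)) * y)

lemma aux_phi_supp (χ : ℝ → ℝ)
    (hχone : ∀ ξ : ℝ, |ξ| ≤ 1 → χ ξ = 1) (hχzero : ∀ ξ : ℝ, 2 ≤ |ξ| → χ ξ = 0)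
    (m : ℕ) (x : ℝ) (h : auxPhi χ m x ≠ 0) : |x| < 2 ^ (m + 1) ∧ (m = 0 ∨ (2:ℝ) ^ m < 2 * |x|) := by
  unfold auxPhi at h
  have hp : (0:ℝ) < 2 ^ m := by positivity
  have e1 : (2:ℝ) ^ (-(m:ℝ)) = (2 ^ m)⁻¹ := by
    rw [Real.rpow_neg (by norm_num), Real.rpow_natCast]
  have e2 : (2:ℝ) ^ (-(m:ℝ) + 1) = (2 ^ m)⁻¹ * 2 := by
    rw [Real.rpow_add (by norm_num), e1, Real.rpow_one]
  rw [e1, e2] at h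
  have a1 : |(2 ^ m : ℝ)⁻¹ * x| = |x| / 2 ^ m := by
    rw [abs_mul, abs_of_pos (by positivity)]; field_simp
  have a2 : |(2 ^ m : ℝ)⁻¹ * 2 * x| = 2 * |x| / 2 ^ m := by
    rw [abs_mul, abs_of_pos (by positivity)]; field_simp
  split_ifs at h with hm
  · subst hm
    refine ⟨?_, Or.inl rfl⟩
    by_contra hc
    push Not at hc
    exact h (hχzero _ (by simpa using hc))
  · constructor
    · by_contra hc
      push Not at hc
      apply h
      rw [hχzero, hχzero, sub_zero]
      · rw [a2, le_div_iff₀ hp]; rw [pow_succ] at hc; nlinarith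
      · rw [a1, le_div_iff₀ hp]; rw [pow_succ] at hc; nlinarith
    · right
      by_contra hc
      push Not at hc
      apply h
      rw [hχone, hχone, sub_self]
      · rw [a2, div_le_iff₀ hp]; linarith
      · rw [a1, div_le_iff₀ hp]; linarith [abs_nonneg x]

lemma aux_phi_window (χ : ℝ → ℝ)
    (hχone : ∀ ξ : ℝ, |ξ| ≤ 1 → χ ξ = 1) (hχzero : ∀ ξ : ℝ, 2 ≤ |ξ| → χ ξ = 0) (x : ℝ) :
    ∃ t : Finset ℕ, t.card ≤ 2 ∧ ∀ m ∉ t, auxPhi χ m x = 0 := by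
  classical
  by_cases H : ∃ m, auxPhi χ m x ≠ 0
  · refine ⟨{Nat.find H, Nat.find H + 1}, Finset.card_le_two, fun m hm => ?_⟩
    by_contra hc
    have h1 := Nat.find_min' H hc
    have h2 := aux_phi_supp χ hχone hχzero _ _ (Nat.find_spec H)
    have h3 := aux_phi_supp χ hχone hχzero _ _ hc
    simp only [Finset.mem_insert, Finset.mem_singleton, not_or] at hm
    have h4 : Nat.find H + 2 ≤ m := by omega
    rcases h3.2 with h | h
    · omega
    · have h5 : (2:ℝ) ^ (Nat.find H + 2) ≤ 2 ^ m := pow_le_pow_right₀ (by norm_num) h4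
      have h6 := h2.1
      rw [pow_succ] at h5
      linarith
  · push Not at H
    exact ⟨∅, by simp, fun m _ => H m⟩

lemma aux_phi_sum_range (χ : ℝ → ℝ) (x : ℝ) (N : ℕ) :
    ∑ m ∈ Finset.range (N + 1), auxPhi χ m x = χ ((2:ℝ) ^ (-(N:ℝ)) * x) := by
  induction N with
  | zero => simp [auxPhi]
  | succ n ih =>
    rw [Finset.sum_range_succ, ih]
    have : auxPhi χ (n + 1) x = χ ((2:ℝ) ^ (-((n + 1 : ℕ):ℝ)) * x)
        - χ ((2:ℝ) ^ (-((n + 1 : ℕ):ℝ) + 1) * x) := by simp [auxPhi]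
    rw [this]
    have e : -((n + 1 : ℕ):ℝ) + 1 = -(n:ℝ) := by push_cast; ring
    rw [e]; ring

lemma aux_phi_tsum (χ : ℝ → ℝ)
    (hχone : ∀ ξ : ℝ, |ξ| ≤ 1 → χ ξ = 1) (hχzero : ∀ ξ : ℝ, 2 ≤ |ξ| → χ ξ = 0) (x : ℝ) :
    ∑' m, auxPhi χ m x = 1 := by
  obtain ⟨N, hN⟩ := pow_unbounded_of_one_lt (2 * |x|) (one_lt_two : (1:ℝ) < 2)
  rw [tsum_eq_sum (s := Finset.range (N + 1)), aux_phi_sum_range]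
  · apply hχone
    rw [Real.rpow_neg (by norm_num), Real.rpow_natCast, abs_mul, abs_of_pos (by positivity),
      inv_mul_le_iff₀ (by positivity)]
    linarith [abs_nonneg x]
  · intro m hm
    by_contra hc
    have h3 := aux_phi_supp χ hχone hχzero _ _ hc
    simp only [Finset.mem_range, not_lt] at hm
    rcases h3.2 with h | h
    · omega
    · have h5 : (2:ℝ) ^ N ≤ 2 ^ m := pow_le_pow_right₀ (by norm_num) (by omega)
      linarith

/-- the bilinear symbol of `T_f u - f u`. -/
def auxSig (χ : ℝ → ℝ) (y x : ℝ) : ℝ := (∑' m : ℕ, auxLow χ ((m:ℤ) - 5) y * auxPhi χ m x) - 1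

lemma aux_sig_zero (χ : ℝ → ℝ)
    (hχone : ∀ ξ : ℝ, |ξ| ≤ 1 → χ ξ = 1) (hχzero : ∀ ξ : ℝ, 2 ≤ |ξ| → χ ξ = 0) (y x : ℝ)
    (h : 64 * (1 + |y|) < |x|) : auxSig χ y x = 0 := by
  have : ∀ m : ℕ, auxLow χ ((m:ℤ) - 5) y * auxPhi χ m x = auxPhi χ m x := by
    intro m
    by_cases hm : auxPhi χ m x = 0
    · simp [hm]
    have h1 := (aux_phi_supp χ hχone hχzero _ _ hm).1
    have h6 : 5 ≤ m := by
      by_contra hc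
      have : (2:ℝ) ^ (m + 1) ≤ 2 ^ 6 := pow_le_pow_right₀ (by norm_num) (by omega)
      have h0 := abs_nonneg y
      have e64 : (2:ℝ) ^ 6 = 64 := by norm_num
      linarith
    obtain ⟨n, rfl⟩ := Nat.exists_eq_add_of_le h6
    have : auxLow χ (((5 + n : ℕ):ℤ) - 5) y = 1 := by
      unfold auxLow
      have e : ((5 + n : ℕ):ℤ) - 5 = (n : ℤ) := by push_cast; ring
      rw [e, if_neg (by omega)]
      apply hχone
      rw [Int.cast_natCast, Real.rpow_neg (by norm_num), Real.rpow_natCast, abs_mul,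
        abs_of_pos (by positivity), inv_mul_le_iff₀ (by positivity)]
      have e2 : (2:ℝ) ^ (5 + n + 1) = 64 * 2 ^ n := by
        rw [show 5 + n + 1 = 6 + n by ring, pow_add]; norm_num
      rw [e2] at h1
      linarith
    rw [this, one_mul]
  unfold auxSig
  rw [tsum_congr this, aux_phi_tsum χ hχone hχzero, sub_self]

lemma aux_phi_abs_le (χ : ℝ → ℝ) (M : ℝ) (hM : ∀ x, |χ x| ≤ M) (m : ℕ) (x : ℝ) :
    |auxPhi χ m x| ≤ 2 * M := by
  have hM0 : 0 ≤ M := (abs_nonneg _).trans (hM 0)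
  unfold auxPhi
  split_ifs
  · linarith [hM x]
  · have h1 := hM ((2:ℝ) ^ (-(m:ℝ)) * x)
    have h2 := hM ((2:ℝ) ^ (-(m:ℝ) + 1) * x)
    exact (abs_sub _ _).trans (by linarith)

lemma aux_low_abs_le (χ : ℝ → ℝ) (M : ℝ) (hM : ∀ x, |χ x| ≤ M) (m : ℤ) (x : ℝ) :
    |auxLow χ m x| ≤ M := by
  have hM0 : 0 ≤ M := (abs_nonneg _).trans (hM 0)
  unfold auxLow
  split_ifs
  · simpa using hM0
  · exact hM _

lemma aux_term_summable (χ : ℝ → ℝ) (M : ℝ) (hM : ∀ x, |χ x| ≤ M)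
    (hχone : ∀ ξ : ℝ, |ξ| ≤ 1 → χ ξ = 1) (hχzero : ∀ ξ : ℝ, 2 ≤ |ξ| → χ ξ = 0) (y x : ℝ) :
    Summable (fun m : ℕ => |auxLow χ ((m:ℤ) - 5) y * auxPhi χ m x|) ∧
    ∑' m : ℕ, |auxLow χ ((m:ℤ) - 5) y * auxPhi χ m x| ≤ 4 * M ^ 2 := by
  have hM0 : 0 ≤ M := (abs_nonneg _).trans (hM 0)
  obtain ⟨t, ht, ht2⟩ := aux_phi_window χ hχone hχzero x
  have hz : ∀ m ∉ t, |auxLow χ ((m:ℤ) - 5) y * auxPhi χ m x| = 0 := by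
    intro m hm; rw [ht2 m hm]; simp
  refine ⟨summable_of_ne_finset_zero hz, ?_⟩
  rw [tsum_eq_sum hz]
  calc _ ≤ ∑ m ∈ t, 2 * M ^ 2 := by
        refine Finset.sum_le_sum fun m _ => ?_
        rw [abs_mul]
        have := mul_le_mul (aux_low_abs_le χ M hM ((m:ℤ) - 5) y) (aux_phi_abs_le χ M hM m x)
          (abs_nonneg _) hM0
        linarith
    _ = t.card * (2 * M ^ 2) := by simp
    _ ≤ 2 * (2 * M ^ 2) := by
        have : (t.card : ℝ) ≤ 2 := by exact_mod_cast ht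
        gcongr
    _ = _ := by ring

lemma aux_sig_le (χ : ℝ → ℝ) (M : ℝ) (hM : ∀ x, |χ x| ≤ M)
    (hχone : ∀ ξ : ℝ, |ξ| ≤ 1 → χ ξ = 1) (hχzero : ∀ ξ : ℝ, 2 ≤ |ξ| → χ ξ = 0) (y x : ℝ) :
    |auxSig χ y x| ≤ 4 * M ^ 2 + 1 := by
  have h := aux_term_summable χ M hM hχone hχzero y x
  unfold auxSig
  refine (abs_sub _ _).trans ?_
  rw [abs_one]
  gcongr
  have h3 := norm_tsum_le_tsum_norm (f := fun m : ℕ => auxLow χ ((m:ℤ) - 5) y * auxPhi χ m x) h.1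
  exact h3.trans h.2

lemma aux_l2_of_Hs (s : ℝ) (hs : 0 ≤ s) (f : Coeffs d) (hf : MemHs s f) :
    Summable (fun n => ‖f n‖ ^ 2) := by
  refine Summable.of_nonneg_of_le (fun _ => by positivity) (fun n => ?_) hf
  have : 1 ≤ jb n ^ (2 * s) := Real.one_le_rpow (aux_jb_one_le n) (by linarith)
  nlinarith [sq_nonneg ‖f n‖]

lemma aux_conv_summable (f u : Coeffs d) (hf : Summable (fun n => ‖f n‖ ^ 2))
    (hu : Summable (fun n => ‖u n‖ ^ 2)) (j : Freq d) :
    Summable (fun n => ‖f n * u (j - n)‖) := by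
  have hu2 : Summable (fun n => ‖u (j - n)‖ ^ 2) :=
    (Equiv.subLeft j).summable_iff.2 hu
  refine Summable.of_nonneg_of_le (fun _ => norm_nonneg _) (fun n => ?_) (hf.add hu2)
  rw [norm_mul]
  nlinarith [sq_nonneg (‖f n‖ - ‖u (j - n)‖), sq_nonneg (‖f n‖), sq_nonneg ‖u (j - n)‖]

lemma aux_repr (k : Fin d → ℝ) (χ : ℝ → ℝ) (M : ℝ) (hM : ∀ x, |χ x| ≤ M)
    (hχone : ∀ ξ : ℝ, |ξ| ≤ 1 → χ ξ = 1) (hχzero : ∀ ξ : ℝ, 2 ≤ |ξ| → χ ξ = 0)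
    (f u : Coeffs d) (hf : Summable (fun n => ‖f n‖ ^ 2))
    (hu : Summable (fun n => ‖u n‖ ^ 2)) (j : Freq d) :
    (Tpara k χ f u - cmul f u) j =
      ∑' n, ((auxSig χ (dotk k n) (dotk k (j - n)) : ℝ) : ℂ) * (f n * u (j - n)) := by
  have h0 := aux_conv_summable f u hf hu j
  let c : Freq d → ℕ → ℝ := fun n m =>
    auxLow χ ((m:ℤ) - 5) (dotk k n) * auxPhi χ m (dotk k (j - n))
  let G : Freq d → ℕ → ℂ := fun n m => ((c n m : ℝ) : ℂ) * (f n * u (j - n))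
  have hc : ∀ n, Summable (fun m => |c n m|) ∧ ∑' m, |c n m| ≤ 4 * M ^ 2 := fun n =>
    aux_term_summable χ M hM hχone hχzero (dotk k n) (dotk k (j - n))
  have hGn : ∀ n m, ‖G n m‖ = |c n m| * ‖f n * u (j - n)‖ := by
    intro n m
    simp only [G, norm_mul, Complex.norm_real, Real.norm_eq_abs]
  have hG : Summable (Function.uncurry G) := by
    apply Summable.of_norm
    rw [summable_prod_of_nonneg (fun _ => norm_nonneg _)]
    simp only [Function.uncurry, hGn]
    refine ⟨fun n => (hc n).1.mul_right _, ?_⟩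
    refine Summable.of_nonneg_of_le (fun n => tsum_nonneg fun m => by positivity) (fun n => ?_)
      (h0.mul_left (4 * M ^ 2))
    rw [tsum_mul_right]
    exact mul_le_mul_of_nonneg_right (hc n).2 (norm_nonneg _)
  have hT : Tpara k χ f u j = ∑' m, ∑' n, G n m := by
    unfold Tpara cmul
    refine tsum_congr fun m => tsum_congr fun n => ?_
    simp only [G, c, LPle, LPproj, auxLow, auxPhi]
    split_ifs <;> push_cast <;> ring
  have hcs : ∀ n, ∑' m, G n m = ((∑' m, c n m : ℝ) : ℂ) * (f n * u (j - n)) := by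
    intro n
    simp only [G]
    rw [tsum_mul_right, Complex.ofReal_tsum]
  rw [Pi.sub_apply, hT, hG.tsum_comm]
  have hsum1 : Summable (fun n => ∑' m, G n m) := hG.prod
  unfold cmul
  rw [← hsum1.tsum_sub h0.of_norm]
  refine tsum_congr fun n => ?_
  rw [hcs]
  simp only [auxSig, c]
  push_cast
  ring

open scoped ENNReal in
lemma aux_l1 (s S : ℝ) (f : Coeffs d) (hf : MemHs s f)
    (hS : HasSum (fun j : Freq d => jb j ^ (1 - 2 * s)) S) :
    (∑' n, ENNReal.ofReal (jb n ^ (1/2:ℝ) * ‖f n‖)) ^ 2 ≤ ENNReal.ofReal (S * HsNorm s f ^ 2) := by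
  have hp : ∀ n : Freq d, 0 < jb n := fun n => lt_of_lt_of_le one_pos (aux_jb_one_le n)
  have hF : HsNorm s f ^ 2 = ∑' j : Freq d, jb j ^ (2 * s) * ‖f j‖ ^ 2 := by
    unfold HsNorm
    rw [Real.sq_sqrt]
    exact tsum_nonneg fun j => mul_nonneg (Real.rpow_nonneg (hp j).le _) (sq_nonneg _)
  have h := aux_CS (fun n : Freq d => ENNReal.ofReal (jb n ^ (1/2 - s)))
    (fun n : Freq d => ENNReal.ofReal (jb n ^ s * ‖f n‖))
  have e1 : ∀ n : Freq d, ENNReal.ofReal (jb n ^ (1/2 - s)) * ENNReal.ofReal (jb n ^ s * ‖f n‖)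
      = ENNReal.ofReal (jb n ^ (1/2:ℝ) * ‖f n‖) := by
    intro n
    rw [← ENNReal.ofReal_mul (Real.rpow_nonneg (hp n).le _), ← mul_assoc, ← Real.rpow_add (hp n)]
    norm_num
  have e2 : ∀ n : Freq d, ENNReal.ofReal (jb n ^ (1/2 - s)) ^ 2
      = ENNReal.ofReal (jb n ^ (1 - 2 * s)) := by
    intro n
    rw [← ENNReal.ofReal_pow (Real.rpow_nonneg (hp n).le _), ← Real.rpow_natCast,
      ← Real.rpow_mul (hp n).le]
    congr 2; push_cast; ring
  have e3 : ∀ n : Freq d, ENNReal.ofReal (jb n ^ s * ‖f n‖) ^ 2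
      = ENNReal.ofReal (jb n ^ (2 * s) * ‖f n‖ ^ 2) := by
    intro n
    rw [← ENNReal.ofReal_pow (mul_nonneg (Real.rpow_nonneg (hp n).le _) (norm_nonneg _)), mul_pow,
      ← Real.rpow_natCast (jb n ^ s), ← Real.rpow_mul (hp n).le]
    congr 3; push_cast; ring
  simp only [e1, e2, e3] at h
  refine h.trans (le_of_eq ?_)
  rw [ENNReal.ofReal_mul (hS.nonneg fun n => Real.rpow_nonneg (hp n).le _), hF, ← hS.tsum_eq,
    ENNReal.ofReal_tsum_of_nonneg (fun n => Real.rpow_nonneg (hp n).le _) hS.summable,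
    ENNReal.ofReal_tsum_of_nonneg
      (fun n => mul_nonneg (Real.rpow_nonneg (hp n).le _) (sq_nonneg _)) hf]

lemma aux_pointwise (k : Fin d → ℝ) (χ : ℝ → ℝ) (M : ℝ) (hM : ∀ x, |χ x| ≤ M)
    (hχone : ∀ ξ : ℝ, |ξ| ≤ 1 → χ ξ = 1) (hχzero : ∀ ξ : ℝ, 2 ≤ |ξ| → χ ξ = 0)
    (j n : Freq d) :
    Real.sqrt (wt k 0 (1/2) j) * |auxSig χ (dotk k n) (dotk k (j - n))| ≤
      (4 * M ^ 2 + 1) * Real.sqrt (65 * (1 + ∑ i, |k i|)) * jb n ^ (1/2:ℝ) := by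
  by_cases h : 64 * (1 + |dotk k n|) < |dotk k (j - n)|
  · rw [aux_sig_zero χ hχone hχzero _ _ h]
    have := aux_jb_one_le n
    have : 0 ≤ jb n := by linarith
    simp only [abs_zero, mul_zero]
    positivity
  · push Not at h
    have h1 : wt k 0 (1/2) j ≤ (65 * (1 + ∑ i, |k i|)) * jb n := by
      unfold wt
      rw [mul_zero, Real.rpow_zero, one_mul, ← Real.sqrt_eq_rpow]
      have hj : |dotk k j| ≤ |dotk k n| + |dotk k (j - n)| := by
        have : dotk k j = dotk k n + dotk k (j - n) := by rw [aux_dotk_add]; ring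
        rw [this]; exact abs_add_le _ _
      have h2 := aux_dotk_le k n
      calc Real.sqrt (1 + dotk k j ^ 2) ≤ 1 + |dotk k j| := by
            rw [Real.sqrt_le_left (by positivity)]
            nlinarith [abs_nonneg (dotk k j), sq_abs (dotk k j)]
        _ ≤ 65 * (1 + |dotk k n|) := by linarith
        _ ≤ _ := by linarith
    have h2 : Real.sqrt (wt k 0 (1/2) j) ≤
        Real.sqrt (65 * (1 + ∑ i, |k i|)) * jb n ^ (1/2:ℝ) := by
      rw [← Real.sqrt_eq_rpow, ← Real.sqrt_mul (by positivity)]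
      exact Real.sqrt_le_sqrt h1
    have h3 := aux_sig_le χ M hM hχone hχzero (dotk k n) (dotk k (j - n))
    have := mul_le_mul h2 h3 (abs_nonneg _) ((Real.sqrt_nonneg _).trans h2)
    linarith

/-- **Lemma 5.4 (Paraproduct error bound).** Let `s > (d+1)/2`. There is a constant
`C = C(d,s,k,χ)` such that for every `f ∈ H^s(𝕋^d)` and every `u ∈ L²(𝕋^d)`,
`‖(T_f − f)u‖_{H^{0,1/2}} ≤ C ‖f‖_{H^s} ‖u‖_{L²}`. -/
theorem paraproduct_error
    (d : ℕ) (hd : 1 ≤ d) (k : Fin d → ℝ) (hk : Indep k)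
    (s : ℝ) (hs : ((d : ℝ) + 1) / 2 < s)
    (χ : ℝ → ℝ) (hχsmooth : ContDiff ℝ (⊤ : ℕ∞) χ) (hχsupp : HasCompactSupport χ)
    (hχone : ∀ ξ : ℝ, |ξ| ≤ 1 → χ ξ = 1) (hχzero : ∀ ξ : ℝ, 2 ≤ |ξ| → χ ξ = 0) :
    ∃ C : ℝ, 0 < C ∧
      ∀ f u : Coeffs d, MemHs s f → MemHs 0 u →
        sobNorm k 0 (1/2) (Tpara k χ f u - cmul f u)
          ≤ C * HsNorm s f * HsNorm 0 u := by

  obtain ⟨M, hM⟩ : ∃ M, ∀ x, |χ x| ≤ M := by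
    obtain ⟨M, hM⟩ := hχsupp.exists_bound_of_continuous hχsmooth.continuous
    exact ⟨M, hM⟩
  have hd0 : (0:ℝ) ≤ d := Nat.cast_nonneg _
  have hs0 : 0 ≤ s := by linarith
  obtain ⟨S, hS⟩ := aux_summable_jb (d := d) (1 - 2 * s) (by linarith)
  have hp : ∀ n : Freq d, 0 < jb n := fun n => lt_of_lt_of_le one_pos (aux_jb_one_le n)
  have hS0 : 0 ≤ S := hS.nonneg fun n => Real.rpow_nonneg (hp n).le _
  set c : ℝ := (4 * M ^ 2 + 1) * Real.sqrt (65 * (1 + ∑ i, |k i|)) with hc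
  have hc0 : 0 ≤ c := by positivity
  clear_value c
  refine ⟨c * Real.sqrt S + 1, by positivity, fun f u hf hu => ?_⟩
  have hf2 := aux_l2_of_Hs s hs0 f hf
  have hu2 := aux_l2_of_Hs 0 le_rfl u hu
  set o : Coeffs d := Tpara k χ f u - cmul f u with ho
  have hF0 : 0 ≤ HsNorm s f := Real.sqrt_nonneg _
  have hU0 : 0 ≤ HsNorm 0 u := Real.sqrt_nonneg _
  have hw : ∀ j, 0 ≤ wt k 0 (1/2) j := fun j => by
    have := (hp j).le
    unfold wt; positivity
  have hU : ∑' j, ENNReal.ofReal ‖u j‖ ^ 2 = ENNReal.ofReal (HsNorm 0 u ^ 2) := by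
    unfold HsNorm
    simp only [mul_zero, Real.rpow_zero, one_mul]
    rw [Real.sq_sqrt (tsum_nonneg fun j => sq_nonneg _),
      ENNReal.ofReal_tsum_of_nonneg (fun j => sq_nonneg _) hu2]
    refine tsum_congr fun j => ?_
    rw [ENNReal.ofReal_pow (norm_nonneg _)]
  have hpt : ∀ j, ENNReal.ofReal (wt k 0 (1/2) j * ‖o j‖ ^ 2) ≤ ENNReal.ofReal c ^ 2 *
      (∑' n, ENNReal.ofReal (jb n ^ (1/2:ℝ) * ‖f n‖) * ENNReal.ofReal ‖u (j - n)‖) ^ 2 := by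
    intro j
    have e : wt k 0 (1/2) j * ‖o j‖ ^ 2 = (Real.sqrt (wt k 0 (1/2) j) * ‖o j‖) ^ 2 := by
      rw [mul_pow, Real.sq_sqrt (hw j)]
    rw [e, ENNReal.ofReal_pow (by positivity), ← mul_pow]
    gcongr
    rw [ENNReal.ofReal_mul (Real.sqrt_nonneg _), ofReal_norm, ho,
      aux_repr k χ M hM hχone hχzero f u hf2 hu2 j, ← ENNReal.tsum_mul_left]
    refine (mul_le_mul_right enorm_tsum_le_tsum_enorm _).trans ?_
    rw [← ENNReal.tsum_mul_left]
    refine ENNReal.tsum_le_tsum fun n => ?_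
    have hj0 : 0 ≤ jb n ^ (1/2:ℝ) := Real.rpow_nonneg (hp n).le _
    rw [← ofReal_norm, ← ENNReal.ofReal_mul (Real.sqrt_nonneg _),
      ← ENNReal.ofReal_mul (by positivity), ← ENNReal.ofReal_mul hc0]
    apply ENNReal.ofReal_le_ofReal
    rw [norm_mul, norm_mul, Complex.norm_real, Real.norm_eq_abs]
    have := mul_le_mul_of_nonneg_right (aux_pointwise k χ M hM hχone hχzero j n)
      (mul_nonneg (norm_nonneg (f n)) (norm_nonneg (u (j - n))))
    rw [← hc] at this
    calc _ = _ := by ring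
      _ ≤ _ := this
      _ = _ := by ring
  have htot : ∑' j, ENNReal.ofReal (wt k 0 (1/2) j * ‖o j‖ ^ 2) ≤
      ENNReal.ofReal (c ^ 2 * ((S * HsNorm s f ^ 2) * HsNorm 0 u ^ 2)) := by
    refine (ENNReal.tsum_le_tsum hpt).trans ?_
    rw [ENNReal.tsum_mul_left, ENNReal.ofReal_mul (sq_nonneg c), ENNReal.ofReal_pow hc0]
    refine mul_le_mul_right ?_ _
    refine (aux_young _ (fun n => ENNReal.ofReal ‖u n‖)).trans ?_
    rw [hU, ENNReal.ofReal_mul (by positivity)]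
    exact mul_le_mul_left (aux_l1 s S f hf hS) _
  have hreal : ∑' j, wt k 0 (1/2) j * ‖o j‖ ^ 2 ≤
      c ^ 2 * ((S * HsNorm s f ^ 2) * HsNorm 0 u ^ 2) := by
    by_cases hsm : Summable (fun j => wt k 0 (1/2) j * ‖o j‖ ^ 2)
    · rw [← ENNReal.ofReal_tsum_of_nonneg
        (fun j => mul_nonneg (hw j) (sq_nonneg _)) hsm] at htot
      exact (ENNReal.ofReal_le_ofReal_iff (by positivity)).1 htot
    · rw [tsum_eq_zero_of_not_summable hsm]; positivity
  have hfin : sobNorm k 0 (1/2) o ≤ c * Real.sqrt S * HsNorm s f * HsNorm 0 u := by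
    unfold sobNorm
    apply Real.sqrt_le_iff.2
    refine ⟨by positivity, hreal.trans (le_of_eq ?_)⟩
    simp only [mul_pow, Real.sq_sqrt hS0]
    ring
  refine hfin.trans ?_
  gcongr
  linarith

end
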